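/- Let E be a real inner product space, A ⊆ E an atomic set symmetric with respect to the origin, y ∈ E and ζ > 0. Suppose x* minimizes the AST objective g(x) = ‖x‖_A + (ζ/2)‖y − x‖² over all x ∈ E with finite atomic norm, and suppose ‖x*‖_A > 0 (in particular x* ≠ 0). Then the dual feasibility inequality is tight: ⟨y − x*, a⟩ ≤ ζ⁻¹ for every a ∈ A, and for every ε > 0 there exists a ∈ A with ⟨y − x*, a⟩ > ζ⁻¹ − ε; equivalently, sup_{a ∈ A} ⟨y − x*, a⟩ = ζ⁻¹. -/

import Mathlib

open scoped RealInnerProductSpace BigOperators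

variable {E : Type*} [NormedAddCommGroup E] [InnerProductSpace ℝ E]

/-- The set of values `∑ i, c i` over all finite conic decompositions
`x = ∑ i, c i • a i` with `c i > 0` and `a i ∈ A`. -/
def decompSums (A : Set E) (x : E) : Set ℝ :=
  { s | ∃ (L : ℕ) (c : Fin L → ℝ) (a : Fin L → E),
      (∀ i, 0 < c i) ∧ (∀ i, a i ∈ A) ∧ x = ∑ i, c i • a i ∧ s = ∑ i, c i }

/-- The atomic norm of `x` w.r.t. the atomic set `A` (as a real infimum; `x` has
finite atomic norm iff `decompSums A x` is nonempty). -/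
noncomputable def atomicNorm (A : Set E) (x : E) : ℝ := sInf (decompSums A x)

/-- The AST objective `g(x) = ‖x‖_A + (ζ/2)‖y − x‖²`. -/
noncomputable def astObj (A : Set E) (ζ : ℝ) (y x : E) : ℝ :=
  atomicNorm A x + ζ / 2 * ‖y - x‖ ^ 2

/-- The mixed-integer AST objective of a finite family `((c i, a i))_{i < L}`. -/
noncomputable def mixedObj (ζ : ℝ) (y : E) {L : ℕ} (c : Fin L → ℝ) (a : Fin L → E) : ℝ :=
  (∑ i, c i) + ζ / 2 * ‖y - ∑ i, c i • a i‖ ^ 2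

/-- A finite family is a global solution of the mixed-integer AST problem if its
objective is at most that of every admissible finite family. -/
def IsGlobalSolution (A : Set E) (ζ : ℝ) (y : E) {L : ℕ}
    (c : Fin L → ℝ) (a : Fin L → E) : Prop :=
  ∀ (L' : ℕ) (c' : Fin L' → ℝ) (a' : Fin L' → E),
    (∀ i, 0 ≤ c' i) → (∀ i, a' i ∈ A) → mixedObj ζ y c a ≤ mixedObj ζ y c' a'

lemma nonneg_of_mem_decompSums {A : Set E} {x : E} {s : ℝ} (hs : s ∈ decompSums A x) :
    0 ≤ s := by
  obtain ⟨L, c, a, hc, -, -, rfl⟩ := hs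
  exact Finset.sum_nonneg fun i _ => (hc i).le

lemma bddBelow_decompSums (A : Set E) (x : E) : BddBelow (decompSums A x) :=
  ⟨0, fun _ hs => nonneg_of_mem_decompSums hs⟩

lemma mul_mem_decompSums {A : Set E} {x : E} {s t : ℝ} (ht : 0 < t)
    (hs : s ∈ decompSums A x) : t * s ∈ decompSums A (t • x) := by
  obtain ⟨L, c, a, hc, ha, rfl, rfl⟩ := hs
  refine ⟨L, fun i => t * c i, a, fun i => mul_pos ht (hc i), ha, ?_, Finset.mul_sum ..⟩
  simp only [Finset.smul_sum, smul_smul]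

lemma add_mem_decompSums {A : Set E} {x a : E} {s t : ℝ} (ht : 0 < t) (ha : a ∈ A)
    (hs : s ∈ decompSums A x) : t + s ∈ decompSums A (t • a + x) := by
  obtain ⟨L, c, b, hc, hb, rfl, rfl⟩ := hs
  refine ⟨L + 1, Fin.cons t c, Fin.cons a b, Fin.cases ht hc, Fin.cases ha hb, ?_, ?_⟩ <;>
    simp [Fin.sum_univ_succ]

lemma atomicNorm_smul_le {A : Set E} {x : E} {t : ℝ} (ht : 0 < t)
    (hx : (decompSums A x).Nonempty) : atomicNorm A (t • x) ≤ t * atomicNorm A x := by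
  rw [← div_le_iff₀' ht]
  refine le_csInf hx fun s hs => ?_
  rw [div_le_iff₀' ht]
  exact csInf_le (bddBelow_decompSums A _) (mul_mem_decompSums ht hs)

lemma atomicNorm_smul_add_le {A : Set E} {x a : E} {t : ℝ} (ht : 0 < t) (ha : a ∈ A)
    (hx : (decompSums A x).Nonempty) : atomicNorm A (t • a + x) ≤ t + atomicNorm A x := by
  rw [← sub_le_iff_le_add']
  refine le_csInf hx fun s hs => ?_
  rw [sub_le_iff_le_add']
  exact csInf_le (bddBelow_decompSums A _) (add_mem_decompSums ht ha hs)

/-- The linear coefficient of a quadratic that is nonnegative on `(0, 1)` and vanishes at `0`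
is nonnegative. -/
lemma nonneg_of_forall_mul_add_sq_mul_nonneg {b c : ℝ} (hc : 0 ≤ c)
    (h : ∀ t : ℝ, 0 < t → t < 1 → 0 ≤ t * b + t ^ 2 * c) : 0 ≤ b := by
  by_contra! hb
  have hd : 0 < c - b + 1 := by linarith
  have ht : 0 < -b / (c - b + 1) := div_pos (by linarith) hd
  have key := h _ ht (by rw [div_lt_one hd]; linarith)
  have hmul : -b / (c - b + 1) * (c - b + 1) = -b := div_mul_cancel₀ _ hd.ne'
  generalize -b / (c - b + 1) = t at *
  have h2 : 0 ≤ b + t * c := by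
    refine nonneg_of_mul_nonneg_right ?_ ht
    linarith [show t * (b + t * c) = t * b + t ^ 2 * c by ring]
  nlinarith

lemma inner_le_mul_of_mem_decompSums {A : Set E} {x r : E} {s m : ℝ}
    (hm : ∀ a ∈ A, ⟪r, a⟫ ≤ m) (hs : s ∈ decompSums A x) : ⟪r, x⟫ ≤ m * s := by
  obtain ⟨L, c, a, hc, ha, rfl, rfl⟩ := hs
  rw [inner_sum, Finset.mul_sum]
  refine Finset.sum_le_sum fun i _ => ?_
  rw [real_inner_smul_right, mul_comm m]
  exact mul_le_mul_of_nonneg_left (hm _ (ha i)) (hc i).le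

section Minimizer

variable {A : Set E} {y xstar : E} {ζ : ℝ}

lemma inner_residual_atom_le (hζ : 0 < ζ) (hx : (decompSums A xstar).Nonempty)
    (hmin : ∀ x : E, (decompSums A x).Nonempty → astObj A ζ y xstar ≤ astObj A ζ y x)
    {a : E} (ha : a ∈ A) : ⟪y - xstar, a⟫ ≤ ζ⁻¹ := by
  have key : 0 ≤ 1 - ζ * ⟪y - xstar, a⟫ := by
    refine nonneg_of_forall_mul_add_sq_mul_nonneg (c := ζ / 2 * ‖a‖ ^ 2) (by positivity)
      fun t ht _ => ?_
    have h := hmin (t • a + xstar) (hx.elim fun _ hs => ⟨_, add_mem_decompSums ht ha hs⟩)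
    have hN := atomicNorm_smul_add_le ht ha hx
    have hsq : ‖y - (t • a + xstar)‖ ^ 2
        = ‖y - xstar‖ ^ 2 - 2 * (t * ⟪y - xstar, a⟫) + t ^ 2 * ‖a‖ ^ 2 := by
      rw [show y - (t • a + xstar) = (y - xstar) - t • a by abel, norm_sub_sq_real,
        real_inner_smul_right, norm_smul, mul_pow, Real.norm_eq_abs, sq_abs]
    unfold astObj at h
    rw [hsq] at h
    linarith
  rw [← one_div, le_div_iff₀' hζ]
  linarith

lemma atomicNorm_le_mul_inner_residual (hζ : 0 < ζ) (hx : (decompSums A xstar).Nonempty)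
    (hmin : ∀ x : E, (decompSums A x).Nonempty → astObj A ζ y xstar ≤ astObj A ζ y x) :
    atomicNorm A xstar ≤ ζ * ⟪y - xstar, xstar⟫ := by
  have key : 0 ≤ ζ * ⟪y - xstar, xstar⟫ - atomicNorm A xstar := by
    refine nonneg_of_forall_mul_add_sq_mul_nonneg (c := ζ / 2 * ‖xstar‖ ^ 2) (by positivity)
      fun t _ ht1 => ?_
    have ht' : 0 < 1 - t := by linarith
    obtain ⟨s, hs⟩ := hx
    have h := hmin ((1 - t) • xstar) ⟨_, mul_mem_decompSums ht' hs⟩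
    have hN := atomicNorm_smul_le ht' ⟨s, hs⟩
    have hsq : ‖y - (1 - t) • xstar‖ ^ 2
        = ‖y - xstar‖ ^ 2 + 2 * (t * ⟪y - xstar, xstar⟫) + t ^ 2 * ‖xstar‖ ^ 2 := by
      rw [show y - (1 - t) • xstar = (y - xstar) + t • xstar by module, norm_add_sq_real,
        real_inner_smul_right, norm_smul, mul_pow, Real.norm_eq_abs, sq_abs]
    unfold astObj at h
    rw [hsq] at h
    linarith
  linarith

end Minimizer

theorem stmt17 (A : Set E) (hA : ∀ a ∈ A, -a ∈ A) (y : E) (ζ : ℝ) (hζ : 0 < ζ)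
    (xstar : E) (hx : (decompSums A xstar).Nonempty)
    (hmin : ∀ x : E, (decompSums A x).Nonempty → astObj A ζ y xstar ≤ astObj A ζ y x)
    (hpos : 0 < atomicNorm A xstar) :
    (∀ a ∈ A, ⟪y - xstar, a⟫ ≤ ζ⁻¹) ∧
      ∀ ε : ℝ, 0 < ε → ∃ a ∈ A, ζ⁻¹ - ε < ⟪y - xstar, a⟫ := by
  refine ⟨fun a ha => inner_residual_atom_le hζ hx hmin ha, fun ε hε => ?_⟩
  by_contra! hm
  have hN := atomicNorm_le_mul_inner_residual hζ hx hmin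
  have hbound : ∀ s ∈ decompSums A xstar, atomicNorm A xstar ≤ (1 - ζ * ε) * s := by
    intro s hs
    calc atomicNorm A xstar ≤ ζ * ⟪y - xstar, xstar⟫ := hN
      _ ≤ ζ * ((ζ⁻¹ - ε) * s) :=
        mul_le_mul_of_nonneg_left (inner_le_mul_of_mem_decompSums hm hs) hζ.le
      _ = (1 - ζ * ε) * s := by field_simp
  have hm_pos : 0 < 1 - ζ * ε := by
    obtain ⟨s, hs⟩ := hx
    exact pos_of_mul_pos_left (hpos.trans_le (hbound s hs)) (nonneg_of_mem_decompSums hs)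
  have hle : atomicNorm A xstar / (1 - ζ * ε) ≤ atomicNorm A xstar :=
    le_csInf hx fun s hs => (div_le_iff₀' hm_pos).2 (hbound s hs)
  rw [div_le_iff₀' hm_pos] at hle
  nlinarith [mul_pos (mul_pos hζ hε) hpos]
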